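/- Let N be a natural number, λ : ℝ, and v : Fin N → ℝ nonzero with J_N.mulVec v = λ • v. Then v is also an eigenvector of the Pascal matrix T_N: there exists μ : ℝ with T_N.mulVec v = μ • v. -/

import Mathlib

open Matrix

/-- The `N × N` symmetric Pascal matrix, `(T_N)_{jk} = C(j+k, j)`. -/
noncomputable def pascalT (N : ℕ) : Matrix (Fin N) (Fin N) ℝ :=
  fun j k => (Nat.choose (j.1 + k.1) j.1 : ℝ)

/-- The `N × N` lower-triangular Pascal matrix, `(Ψ_N)_{jk} = C(j, k)`. -/
noncomputable def psiMat (N : ℕ) : Matrix (Fin N) (Fin N) ℝ :=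
  fun j k => (Nat.choose j.1 k.1 : ℝ)

/-- The `N × N` diagonal sign matrix `Λ_N = diag(1, -1, 1, …)`. -/
noncomputable def lamMat (N : ℕ) : Matrix (Fin N) (Fin N) ℝ :=
  Matrix.diagonal fun j => (-1 : ℝ) ^ j.1

/-- The `N × N` symmetric tridiagonal (Jacobi) matrix `J_N` with diagonal entries
`(J_N)_{jj} = -N²·j + 2j³ + 3j² + 2j` and off-diagonal entries
`(J_N)_{j,j+1} = (J_N)_{j+1,j} = (j+1)·(N² - (j+1)²)`. -/
noncomputable def jacobiJ (N : ℕ) : Matrix (Fin N) (Fin N) ℝ :=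
  fun j k =>
    if j.1 = k.1 then
      -((N : ℝ) ^ 2) * (j.1 : ℝ) + 2 * (j.1 : ℝ) ^ 3 + 3 * (j.1 : ℝ) ^ 2 + 2 * (j.1 : ℝ)
    else if j.1 + 1 = k.1 then (k.1 : ℝ) * ((N : ℝ) ^ 2 - (k.1 : ℝ) ^ 2)
    else if k.1 + 1 = j.1 then (j.1 : ℝ) * ((N : ℝ) ^ 2 - (j.1 : ℝ) ^ 2)
    else 0

/-- The action of `J_N` as a three-term recurrence; the boundary terms vanish on their own. -/
theorem sum_jacobiJ_mul (N : ℕ) (j : Fin N) (g : ℕ → ℝ) :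
    ∑ k : Fin N, jacobiJ N j k * g k =
      (j : ℝ) * ((N : ℝ) ^ 2 - (j : ℝ) ^ 2) * g (j - 1)
      + (-((N : ℝ) ^ 2) * (j : ℝ) + 2 * (j : ℝ) ^ 3 + 3 * (j : ℝ) ^ 2 + 2 * (j : ℝ)) * g j
      + ((j : ℝ) + 1) * ((N : ℝ) ^ 2 - ((j : ℝ) + 1) ^ 2) * g (j + 1) := by
  obtain ⟨j, hj⟩ := j
  have key : ∀ k : ℕ, (if j = k then
      -((N : ℝ) ^ 2) * (j : ℝ) + 2 * (j : ℝ) ^ 3 + 3 * (j : ℝ) ^ 2 + 2 * (j : ℝ)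
      else if j + 1 = k then (k : ℝ) * ((N : ℝ) ^ 2 - (k : ℝ) ^ 2)
      else if k + 1 = j then (j : ℝ) * ((N : ℝ) ^ 2 - (j : ℝ) ^ 2) else 0) * g k =
      (if j - 1 = k then (j : ℝ) * ((N : ℝ) ^ 2 - (j : ℝ) ^ 2) * g (j - 1) else 0)
      + (if j = k then (-((N : ℝ) ^ 2) * (j : ℝ) + 2 * (j : ℝ) ^ 3 + 3 * (j : ℝ) ^ 2
          + 2 * (j : ℝ)) * g j else 0)
      + (if j + 1 = k then ((j : ℝ) + 1) * ((N : ℝ) ^ 2 - ((j : ℝ) + 1) ^ 2) * g (j + 1)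
          else 0) := by
    intro k
    rcases Nat.eq_zero_or_pos j with rfl | hpos
    · by_cases h0 : 0 = k
      · subst h0; simp
      · by_cases h1 : 1 = k
        · subst h1; simp
        · simp [h0, h1]
    · by_cases h0 : j = k
      · subst h0
        simp [show j - 1 ≠ j by omega]
      · by_cases h1 : j + 1 = k
        · subst h1
          simp [show j - 1 ≠ j + 1 by omega]
        · by_cases h2 : k + 1 = j
          · subst h2; simp [show k + 1 + 1 ≠ k by omega]
          · simp [h0, h1, h2, show j - 1 ≠ k by omega]
  simp only [jacobiJ]
  rw [Fin.sum_univ_eq_sum_range (fun k : ℕ => (if j = k then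
      -((N : ℝ) ^ 2) * (j : ℝ) + 2 * (j : ℝ) ^ 3 + 3 * (j : ℝ) ^ 2 + 2 * (j : ℝ)
      else if j + 1 = k then (k : ℝ) * ((N : ℝ) ^ 2 - (k : ℝ) ^ 2)
      else if k + 1 = j then (j : ℝ) * ((N : ℝ) ^ 2 - (j : ℝ) ^ 2) else 0) * g k) N]
  simp only [key, Finset.sum_add_distrib, Finset.sum_ite_eq, Finset.mem_range, hj,
    show j - 1 < N by omega, if_true]
  congr 1
  split_ifs with h
  · rfl
  · have : N = j + 1 := by omega
    subst this
    push_cast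
    ring

/-- `J_N` is symmetric. -/
theorem jacobiJ_transpose (N : ℕ) : (jacobiJ N)ᵀ = jacobiJ N := by
  ext j k
  simp only [transpose_apply, jacobiJ]
  split_ifs <;> first | omega | rfl | simp_all

/-- The Pascal matrix is symmetric. -/
theorem pascalT_transpose (N : ℕ) : (pascalT N)ᵀ = pascalT N := by
  ext j k
  simp only [transpose_apply, pascalT]
  rw [add_comm, Nat.choose_symm_add]

/-- The entries of `J_N T_N`, cleared of denominators. -/
theorem add_mul_jacobiJ_mul_pascalT_apply (N : ℕ) (j k : Fin N) :
    ((j : ℝ) + k) * (jacobiJ N * pascalT N) j k =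
      ((j : ℝ) ^ 2 * ((N : ℝ) ^ 2 - (j : ℝ) ^ 2)
        + ((j : ℝ) + k)
          * (-((N : ℝ) ^ 2) * (j : ℝ) + 2 * (j : ℝ) ^ 3 + 3 * (j : ℝ) ^ 2 + 2 * (j : ℝ))
        + ((j : ℝ) + k) * ((j : ℝ) + k + 1) * ((N : ℝ) ^ 2 - ((j : ℝ) + 1) ^ 2))
      * (Nat.choose (j + k) j : ℝ) := by
  rw [mul_apply]
  simp only [pascalT]
  rw [sum_jacobiJ_mul N j (fun i => (Nat.choose (i + k) i : ℝ))]
  obtain ⟨j, hj⟩ := j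
  obtain ⟨k, hk⟩ := k
  simp only
  have up : ((j : ℝ) + 1) * (Nat.choose (j + 1 + k) (j + 1) : ℝ)
      = ((j : ℝ) + k + 1) * (Nat.choose (j + k) j : ℝ) := by
    have := Nat.add_one_mul_choose_eq (j + k) j
    rw [show j + k + 1 = j + 1 + k by ring] at this
    have h2 : (((j + 1 + k : ℕ) : ℝ)) * ((j + k).choose j : ℝ)
      = ((j + 1 + k).choose (j + 1) : ℝ) * ((j + 1 : ℕ) : ℝ) := by exact_mod_cast this
    push_cast at h2
    linarith
  have down : (j : ℝ) * (((j : ℝ) + k) * (Nat.choose (j - 1 + k) (j - 1) : ℝ))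
      = (j : ℝ) ^ 2 * (Nat.choose (j + k) j : ℝ) := by
    cases j with
    | zero => simp
    | succ i =>
      have := Nat.add_one_mul_choose_eq (i + k) i
      rw [show i + k + 1 = i + 1 + k by ring] at this
      have h2 : (((i + 1 + k : ℕ) : ℝ)) * ((i + k).choose i : ℝ)
        = ((i + 1 + k).choose (i + 1) : ℝ) * ((i + 1 : ℕ) : ℝ) := by exact_mod_cast this
      push_cast at h2 ⊢
      linear_combination ((i : ℝ) + 1) * h2
  linear_combination ((N : ℝ) ^ 2 - (j : ℝ) ^ 2) * down
    + ((j : ℝ) + k) * ((N : ℝ) ^ 2 - ((j : ℝ) + 1) ^ 2) * up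

/-- `J_N` and `T_N` commute. -/
theorem jacobiJ_mul_pascalT_comm (N : ℕ) :
    jacobiJ N * pascalT N = pascalT N * jacobiJ N := by
  have symm : (jacobiJ N * pascalT N)ᵀ = jacobiJ N * pascalT N := by
    ext j k
    rw [transpose_apply]
    by_cases hjk : j = k
    · rw [hjk]
    · have hpos : ((j : ℝ) + k) ≠ 0 := by
        have : j.1 ≠ k.1 := fun e => hjk (Fin.ext e)
        exact_mod_cast (show j.1 + k.1 ≠ 0 by omega)
      apply mul_left_cancel₀ hpos
      have h1 := add_mul_jacobiJ_mul_pascalT_apply N j k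
      have h2 := add_mul_jacobiJ_mul_pascalT_apply N k j
      rw [add_comm k.1 j.1, ← Nat.choose_symm_add] at h2
      linear_combination h2 - h1
  rw [← symm, transpose_mul, jacobiJ_transpose, pascalT_transpose]

/-- An eigenvector of `J_N` is determined by its first entry. -/
theorem eq_zero_of_jacobiJ_mulVec_eq_smul {N : ℕ} {lam : ℝ} {u : Fin N → ℝ}
    (h : (jacobiJ N).mulVec u = lam • u) (h0 : ∀ i : Fin N, i.1 = 0 → u i = 0) : u = 0 := by
  set g : ℕ → ℝ := (fun i => if hi : i < N then u ⟨i, hi⟩ else 0) with hg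
  have hgu : ∀ i : Fin N, g i = u i := fun i => by simp [hg]
  have step : ∀ i (hi : i < N), g (i - 1) = 0 → g i = 0 → i + 1 < N → g (i + 1) = 0 := by
    intro i hi hm hz hlt
    have e := congrFun h ⟨i, hi⟩
    simp only [mulVec, dotProduct, Pi.smul_apply, smul_eq_mul, ← hgu] at e
    rw [sum_jacobiJ_mul N ⟨i, hi⟩ g] at e
    simp only [hm, hz, mul_zero, zero_add] at e
    refine (mul_eq_zero.mp e).resolve_left (mul_ne_zero (by positivity) ?_)
    have : (i : ℝ) + 1 < N := by exact_mod_cast hlt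
    have hi0 : (0 : ℝ) ≤ i := by positivity
    nlinarith
  have all : ∀ i, g (i - 1) = 0 ∧ g i = 0 := by
    intro i
    induction i with
    | zero =>
      have : g 0 = 0 := by
        simp only [hg]
        split_ifs with hN
        · exact h0 _ rfl
        · rfl
      exact ⟨this, this⟩
    | succ i ih =>
      refine ⟨ih.2, ?_⟩
      by_cases hlt : i + 1 < N
      · exact step i (by omega) ih.1 ih.2 hlt
      · simp [hg, hlt]
  ext i
  rw [← hgu]
  exact (all i).2

/-- Every nonzero eigenvector of the Jacobi matrix `J_N` is also an eigenvector of the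
Pascal matrix `T_N`. -/
theorem jacobi_eigenvector_is_pascal_eigenvector (N : ℕ) (lam : ℝ) (v : Fin N → ℝ)
    (hv : v ≠ 0) (h : (jacobiJ N).mulVec v = lam • v) :
    ∃ mu : ℝ, (pascalT N).mulVec v = mu • v := by
  have hN : 0 < N := by
    by_contra hN
    obtain rfl : N = 0 := by omega
    exact hv (Subsingleton.elim _ _)
  have hv0 : v ⟨0, hN⟩ ≠ 0 := fun h0 => hv <|
    eq_zero_of_jacobiJ_mulVec_eq_smul h fun i hi => by
      rwa [show i = ⟨0, hN⟩ from Fin.ext hi]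
  refine ⟨(pascalT N).mulVec v ⟨0, hN⟩ / v ⟨0, hN⟩, ?_⟩
  rw [← sub_eq_zero]
  refine eq_zero_of_jacobiJ_mulVec_eq_smul (lam := lam) ?_ fun i hi => ?_
  · rw [mulVec_sub, mulVec_smul, mulVec_mulVec, jacobiJ_mul_pascalT_comm, ← mulVec_mulVec, h,
      mulVec_smul, smul_sub, smul_comm lam]
  · rw [show i = ⟨0, hN⟩ from Fin.ext hi]
    simp [hv0]
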